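/- Let W be an (α,m,N)-source over {0,1}^n and let E : {0,1}^m × {0,1}^r → {0,1}^ν be an average case (m,α,ν,ε)-extractor with the additional property that E(Ũ, Z) is uniform over {0,1}^ν whenever Ũ is uniform over {0,1}^m and Z is an independent uniform seed. Let ν = t + ξ + 2λ. Let Z be uniform over {0,1}^r, let A_1,…,A_ℓ be independent uniformly random subsets of {1,…,n} of cardinality m, all independent of W, let R be uniform over {0,1}^ξ and R₁ be uniform over {0,1}^{2λ}, with (R,R₁) independent of everything else, and set p_i = E(W[A_i], Z) ⊕ (0^t | R | R₁) for i = 1,…,ℓ. Let T = f(R₁, (p_1,…,p_ℓ, Z, A_1,…,A_ℓ)) for any function f into a finite set (in the scheme, T is the tag x^L + x²·m(x) + x·y, where R₁ is parsed as x|y with x, y ∈ GF(2^λ) and m is the vector over GF(2^λ) of length L−4 encoding p_1|…|p_ℓ). If ℓ·m < N, then Δ((R, p_1,…,p_ℓ, Z, A_1,…,A_ℓ, T); (U, p_1,…,p_ℓ, Z, A_1,…,A_ℓ, T)) ≤ 4ℓ·ε, where U is uniform over {0,1}^ξ independent of all the other variables. -/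

import Mathlib

noncomputable section

/-- Statistical distance between two PMFs on a finite type. -/
def statDist {T : Type*} [Fintype T] (p q : PMF T) : ℝ :=
  (1 / 2) * ∑ v : T, |(p v).toReal - (q v).toReal|

/-- Independent product of two PMFs. -/
def pmfProd {α β : Type*} (p : PMF α) (q : PMF β) : PMF (α × β) :=
  p.bind fun a => q.map fun b => (a, b)

/-- Average conditional min-entropy of a joint distribution on X × Y. -/
def avgCondMinEntropy {X Y : Type*} [Fintype X] [Fintype Y] (μ : PMF (X × Y)) : ℝ :=
  - Real.logb 2 (∑ y : Y, ⨆ x : X, (μ (x, y)).toReal)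

/-- Average case `(·,α,·,ε)`-extractor. -/
def IsAvgExtractor {𝒳 𝒮 𝒴 : Type*} [Fintype 𝒳] [Fintype 𝒮] [Nonempty 𝒮]
    [Fintype 𝒴] [Nonempty 𝒴] (E : 𝒳 → 𝒮 → 𝒴) (α ε : ℝ) : Prop :=
  ∀ (Aux : Type) [Fintype Aux], ∀ μ : PMF (𝒳 × Aux),
    α ≤ avgCondMinEntropy μ →
    statDist
      ((pmfProd μ (PMF.uniformOfFintype 𝒮)).map fun z => (E z.1.1 z.2, z.1.2, z.2))
      ((pmfProd (pmfProd μ (PMF.uniformOfFintype 𝒮)) (PMF.uniformOfFintype 𝒴)).map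
        fun z => (z.2, z.1.1.2, z.1.2))
      ≤ ε

lemma mSub_nonempty {α : Type*} [Fintype α] [DecidableEq α] {m : ℕ}
    (h : m ≤ Fintype.card α) : Nonempty {A : Finset α // A.card = m} := by
  obtain ⟨t, -, ht⟩ := Finset.exists_subset_card_eq
    (show m ≤ (Finset.univ : Finset α).card by simpa using h)
  exact ⟨⟨t, ht⟩⟩

/-- `k` independent uniformly random `m`-subsets. -/
def uniformSubsets (α : Type*) [Fintype α] [DecidableEq α] (m k : ℕ)
    (h : m ≤ Fintype.card α) : PMF (Fin k → {A : Finset α // A.card = m}) :=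
  haveI : Nonempty {A : Finset α // A.card = m} := mSub_nonempty h
  PMF.uniformOfFintype _

/-- A uniformly random `m`-subset. -/
def uniformSubset (α : Type*) [Fintype α] [DecidableEq α] (m : ℕ)
    (h : m ≤ Fintype.card α) : PMF {A : Finset α // A.card = m} :=
  haveI : Nonempty {A : Finset α // A.card = m} := mSub_nonempty h
  PMF.uniformOfFintype _

/-- The masked substring `w[A]`. -/
def subsample {α : Type*} [DecidableEq α] (w : α → Bool) (A : Finset α) :
    α → Option Bool :=
  fun i => if i ∈ A then some (w i) else none

/-- The substring of `w` indexed by the `m`-subset `A` (in increasing order of positions). -/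
def sampleBits {n m : ℕ} (w : Fin n → Bool) (A : {s : Finset (Fin n) // s.card = m}) :
    Fin m → Bool :=
  fun i => w (A.1.orderIsoOfFin A.2 i).1

/-- `(α,m,N)`-source over `{0,1}^n`. -/
def IsAlphaSource (n : ℕ) (Wd : PMF (Fin n → Bool)) (α : ℝ) (m N : ℕ)
    (hm : m ≤ n) (hN : N ≤ n) : Prop :=
  α ≤ avgCondMinEntropy (do
    let w ← Wd
    let A ← uniformSubset (Fin n) m (by simpa using hm)
    let B ← uniformSubset (Fin n) N (by simpa using hN)
    return (subsample w A.1, (subsample w B.1, A, B)))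

/-! ### Finite distributions -/

lemma PMF.sum_toReal {α : Type*} [Fintype α] (p : PMF α) : ∑ a, (p a).toReal = 1 := by
  rw [← ENNReal.toReal_sum fun a _ => p.apply_ne_top a, ← tsum_fintype (L := .unconditional α),
    p.tsum_coe, ENNReal.toReal_one]

lemma PMF.toReal_bind {α β : Type*} [Fintype α] (p : PMF α) (K : α → PMF β) (b : β) :
    ((p.bind K) b).toReal = ∑ a, (p a).toReal * (K a b).toReal := by
  rw [PMF.bind_apply, tsum_fintype, ENNReal.toReal_sum
    fun a _ => ENNReal.mul_ne_top (p.apply_ne_top a) ((K a).apply_ne_top b)]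
  simp only [ENNReal.toReal_mul]

lemma PMF.bind_congr_support {α β : Type*} (p : PMF α) {K L : α → PMF β}
    (h : ∀ a ∈ p.support, K a = L a) : p.bind K = p.bind L := by
  ext b
  simp only [PMF.bind_apply]
  refine tsum_congr fun a => ?_
  by_cases ha : p a = 0
  · simp [ha]
  · rw [h a ((p.mem_support_iff a).2 ha)]

lemma PMF.uniformOfFintype_map_equiv {α β : Type*} [Fintype α] [Nonempty α] [Fintype β]
    [Nonempty β] (e : α ≃ β) :
    (PMF.uniformOfFintype α).map e = PMF.uniformOfFintype β := by
  classical
  ext b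
  rw [PMF.map_apply, tsum_eq_single (e.symm b)]
  · simp [Fintype.card_congr e]
  · intro a ha
    rw [if_neg]
    rintro rfl
    simp at ha

/-- Resampling one coordinate of a uniform function leaves it uniform. -/
lemma PMF.uniformOfFintype_update {ι X : Type*} [Fintype ι] [DecidableEq ι] [Fintype X]
    [Nonempty X] (i : ι) :
    ((PMF.uniformOfFintype (ι → X)).bind fun u =>
      (PMF.uniformOfFintype X).bind fun x => PMF.pure (Function.update u i x)) =
      PMF.uniformOfFintype (ι → X) := by
  classical
  ext v
  have key : ∀ u : ι → X, ((PMF.uniformOfFintype X).bind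
      fun x => PMF.pure (Function.update u i x)) v =
      if Function.update u i (v i) = v then (Fintype.card X : ENNReal)⁻¹ else 0 := by
    intro u
    rw [PMF.bind_apply, tsum_eq_single (v i)]
    · by_cases h : Function.update u i (v i) = v
      · simp [h]
      · simp [h, Ne.symm h]
    · intro x hx
      have : v ≠ Function.update u i x := by
        rintro rfl
        simp at hx
      simp [this]
  have hS : (Finset.univ.filter fun u : ι → X => Function.update u i (v i) = v) =
      Finset.univ.image fun x => Function.update v i x := by
    ext u
    simp only [Finset.mem_filter, Finset.mem_univ, true_and, Finset.mem_image]
    constructor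
    · intro h
      refine ⟨u i, ?_⟩
      rw [← h]
      simp
    · rintro ⟨x, rfl⟩
      simp
  rw [PMF.bind_apply, tsum_fintype]
  simp only [key, PMF.uniformOfFintype_apply, mul_ite, mul_zero]
  rw [← Finset.sum_filter, hS, Finset.sum_const, Finset.card_image_of_injective _
    (Function.update_injective v i), Finset.card_univ, nsmul_eq_mul, mul_left_comm,
    ENNReal.mul_inv_cancel (by simp) (by simp), mul_one]

/-- Choosing a uniform point of the base and then a uniform point of its fibre is a uniform
choice, when all fibres have the same positive size. -/
lemma PMF.uniformOfFintype_bind_fiber {G Y : Type*} [Fintype G] [Nonempty G] [Fintype Y]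
    [Nonempty Y] [DecidableEq Y] (φ : G → Y)
    (hne : ∀ y, (Finset.univ.filter fun g => φ g = y).Nonempty)
    (hcard : ∀ y y', (Finset.univ.filter fun g => φ g = y).card =
      (Finset.univ.filter fun g => φ g = y').card) :
    ((PMF.uniformOfFintype Y).bind fun y => PMF.uniformOfFinset _ (hne y)) =
      PMF.uniformOfFintype G := by
  ext g
  rw [PMF.bind_apply, tsum_eq_single (φ g)]
  · have h : Fintype.card G =
        Fintype.card Y * (Finset.univ.filter fun a => φ a = φ g).card := by
      rw [← Finset.card_univ, Finset.card_eq_sum_card_fiberwise (f := φ) (t := Finset.univ)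
        (fun _ _ => Finset.mem_coe.2 (Finset.mem_univ _)),
        Finset.sum_congr rfl fun y _ => hcard y (φ g)]
      simp
    rw [PMF.uniformOfFinset_apply_of_mem _ (by simp), PMF.uniformOfFintype_apply,
      PMF.uniformOfFintype_apply, h, Nat.cast_mul,
      ENNReal.mul_inv (Or.inr (ENNReal.natCast_ne_top _)) (Or.inl (ENNReal.natCast_ne_top _))]
  · intro y hy
    rw [PMF.uniformOfFinset_apply_of_notMem _ (by simpa using Ne.symm hy), mul_zero]

/-! ### Statistical distance -/

lemma statDist_nonneg {T : Type*} [Fintype T] (p q : PMF T) : 0 ≤ statDist p q :=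
  mul_nonneg (by norm_num) (Finset.sum_nonneg fun _ _ => abs_nonneg _)

lemma statDist_self {T : Type*} [Fintype T] (p : PMF T) : statDist p p = 0 := by
  simp [statDist]

lemma statDist_comm {T : Type*} [Fintype T] (p q : PMF T) : statDist p q = statDist q p := by
  simp only [statDist, abs_sub_comm]

lemma statDist_triangle {T : Type*} [Fintype T] (p q s : PMF T) :
    statDist p s ≤ statDist p q + statDist q s := by
  simp only [statDist, ← mul_add, ← Finset.sum_add_distrib]
  gcongr
  exact abs_sub_le _ _ _

/-- Data processing inequality. -/
lemma statDist_bind_le {S T : Type*} [Fintype S] [Fintype T] (p q : PMF S) (K : S → PMF T) :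
    statDist (p.bind K) (q.bind K) ≤ statDist p q := by
  simp only [statDist, PMF.toReal_bind]
  gcongr
  calc ∑ v, |∑ a, (p a).toReal * (K a v).toReal - ∑ a, (q a).toReal * (K a v).toReal|
      ≤ ∑ v, ∑ a, |(p a).toReal - (q a).toReal| * (K a v).toReal := by
        gcongr with v
        rw [← Finset.sum_sub_distrib]
        refine (Finset.abs_sum_le_sum_abs _ _).trans_eq (Finset.sum_congr rfl fun a _ => ?_)
        rw [← sub_mul, abs_mul, abs_of_nonneg (ENNReal.toReal_nonneg (a := K a v))]
    _ = ∑ a, |(p a).toReal - (q a).toReal| := by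
        rw [Finset.sum_comm]
        simp only [← Finset.mul_sum, PMF.sum_toReal, mul_one]

lemma statDist_le_of_chain {T : Type*} [Fintype T] (D : ℕ → PMF T) (ε : ℝ) (k : ℕ)
    (h : ∀ i < k, statDist (D i) (D (i + 1)) ≤ ε) : statDist (D 0) (D k) ≤ k * ε := by
  induction k with
  | zero => simp [statDist_self]
  | succ k ih =>
    have h₁ := ih fun i hi => h i (hi.trans k.lt_succ_self)
    have h₂ := h k k.lt_succ_self
    have h₃ := statDist_triangle (D 0) (D k) (D (k + 1))
    push_cast
    linarith

/-! ### Conditional min-entropy -/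

/-- Recoding the secret as a function of itself and the side information cannot increase the
average conditional min-entropy. -/
lemma avgCondMinEntropy_map_le {X X' Y : Type*} [Fintype X] [Fintype X'] [Fintype Y]
    (μ : PMF (X × Y)) (g : X → Y → X') :
    avgCondMinEntropy (μ.map fun z => (g z.1 z.2, z.2)) ≤ avgCondMinEntropy μ := by
  unfold avgCondMinEntropy
  have hbd : ∀ y, BddAbove (Set.range fun x => (μ (x, y)).toReal) :=
    fun y => Set.Finite.bddAbove (Set.finite_range _)
  have hnn : ∀ y, 0 ≤ ⨆ x, (μ (x, y)).toReal :=
    fun y => Real.iSup_nonneg fun _ => ENNReal.toReal_nonneg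
  refine neg_le_neg (Real.logb_le_logb_of_le (by norm_num) ?_ ?_)
  · obtain ⟨⟨x, y⟩, h⟩ := μ.support_nonempty
    have hpos : 0 < (μ (x, y)).toReal :=
      ENNReal.toReal_pos ((μ.mem_support_iff _).1 h) (μ.apply_ne_top _)
    exact (hpos.trans_le (le_ciSup (hbd y) x)).trans_le
      (Finset.single_le_sum (f := fun y => ⨆ x, (μ (x, y)).toReal)
        (fun y _ => hnn y) (Finset.mem_univ y))
  · refine Finset.sum_le_sum fun y _ => ?_
    refine Real.iSup_le (fun x => ?_) (Real.iSup_nonneg fun _ => ENNReal.toReal_nonneg)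
    refine le_trans ?_ (le_ciSup (Set.Finite.bddAbove (Set.finite_range _)) (g x y))
    refine ENNReal.toReal_mono (PMF.apply_ne_top _ _) ?_
    classical
    rw [PMF.map_apply]
    refine le_trans ?_ (ENNReal.le_tsum (x, y))
    simp

/-! ### Random subsets -/

/-- A permutation acts on subsets of a given size. -/
def permSubset {α : Type*} [DecidableEq α] (k : ℕ) (σ : Equiv.Perm α) :
    {A : Finset α // A.card = k} ≃ {A : Finset α // A.card = k} where
  toFun A := ⟨A.1.map σ.toEmbedding, by simp [A.2]⟩
  invFun A := ⟨A.1.map σ.symm.toEmbedding, by simp [A.2]⟩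
  left_inv A := by ext; simp
  right_inv A := by ext; simp

lemma permSubset_mul {α : Type*} [DecidableEq α] {k : ℕ} (σ τ : Equiv.Perm α)
    (A : {A : Finset α // A.card = k}) :
    permSubset k (σ * τ) A = permSubset k σ (permSubset k τ A) := by
  apply Subtype.ext
  ext x
  simp [permSubset]
  rfl

lemma exists_permSubset_eq {α : Type*} [Fintype α] [DecidableEq α] {k : ℕ}
    (A B : {A : Finset α // A.card = k}) : ∃ σ, permSubset k σ A = B := by
  have e : {x // x ∈ A.1} ≃ {x // x ∈ B.1} :=
    Fintype.equivOfCardEq (by simp [A.2, B.2])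
  refine ⟨e.extendSubtype, Subtype.ext (Finset.eq_of_subset_of_card_le ?_ ?_)⟩
  · intro x hx
    obtain ⟨a, ha, rfl⟩ := Finset.mem_map.1 hx
    exact e.extendSubtype_mem a ha
  · simp [permSubset, A.2, B.2]

/-- `ℓ` independent uniform `m`-subsets can be sampled inside a uniform `N`-subset
when `ℓ * m ≤ N`. -/
lemma exists_kernel_uniformSubsets {α : Type*} [Fintype α] [DecidableEq α] {m N ℓ : ℕ}
    (hm : m ≤ Fintype.card α) (hN : N ≤ Fintype.card α) (h : ℓ * m ≤ N) :
    ∃ κ : {B : Finset α // B.card = N} → PMF (Fin ℓ → {A : Finset α // A.card = m}),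
      (uniformSubset α N hN).bind κ = uniformSubsets α m ℓ hm ∧
      ∀ B, ∀ A ∈ (κ B).support, ∀ j, (A j).1 ⊆ B.1 := by
  have : Nonempty {A : Finset α // A.card = m} := mSub_nonempty hm
  have : Nonempty {A : Finset α // A.card = N} := mSub_nonempty hN
  have hC : ∀ A : Fin ℓ → {A : Finset α // A.card = m},
      ∃ C : {B : Finset α // B.card = N}, ∀ j, (A j).1 ⊆ C.1 := by
    intro A
    have hcard : (Finset.univ.biUnion fun j => (A j).1).card ≤ N := by
      refine (Finset.card_biUnion_le_card_mul _ _ m fun j _ => (A j).2.le).trans ?_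
      simpa using h
    obtain ⟨C, hAC, -, hC⟩ := Finset.exists_subsuperset_card_eq
      (Finset.subset_univ _) hcard (by simpa using hN)
    exact ⟨⟨C, hC⟩, fun j => (Finset.subset_biUnion_of_mem (fun j => (A j).1)
      (Finset.mem_univ j)).trans hAC⟩
  choose C hC using hC
  have hne : ∀ (A : Fin ℓ → {A : Finset α // A.card = m}) (B : {B : Finset α // B.card = N}),
      (Finset.univ.filter fun σ : Equiv.Perm α => permSubset N σ (C A) = B).Nonempty := by
    intro A B
    obtain ⟨σ, hσ⟩ := exists_permSubset_eq (C A) B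
    exact ⟨σ, by simpa using hσ⟩
  have hcard : ∀ (A : Fin ℓ → {A : Finset α // A.card = m})
      (B B' : {B : Finset α // B.card = N}),
      (Finset.univ.filter fun σ : Equiv.Perm α => permSubset N σ (C A) = B).card =
      (Finset.univ.filter fun σ : Equiv.Perm α => permSubset N σ (C A) = B').card := by
    intro A B B'
    obtain ⟨τ, rfl⟩ := exists_permSubset_eq B B'
    refine Finset.card_equiv (Equiv.mulLeft τ) fun σ => ?_
    simp [permSubset_mul]
  refine ⟨fun B => (uniformSubsets α m ℓ hm).bind fun A =>
    (PMF.uniformOfFinset _ (hne A B)).bind fun σ => PMF.pure fun j => permSubset m σ (A j),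
    ?_, ?_⟩
  · have hfib : ∀ A, ((uniformSubset α N hN).bind fun B =>
        (PMF.uniformOfFinset _ (hne A B)).bind fun σ =>
          PMF.pure fun j => permSubset m σ (A j)) =
        (PMF.uniformOfFintype (Equiv.Perm α)).bind fun σ =>
          PMF.pure fun j => permSubset m σ (A j) := by
      intro A
      rw [← PMF.uniformOfFintype_bind_fiber (fun σ => permSubset N σ (C A)) (hne A) (hcard A),
        PMF.bind_bind]
      rfl
    have hmap : ∀ σ : Equiv.Perm α, ((uniformSubsets α m ℓ hm).bind fun A =>
        PMF.pure fun j => permSubset m σ (A j)) = uniformSubsets α m ℓ hm := fun σ =>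
      PMF.uniformOfFintype_map_equiv (Equiv.piCongrRight fun _ : Fin ℓ => permSubset m σ)
    rw [PMF.bind_comm]
    simp only [hfib]
    rw [PMF.bind_comm]
    simp only [hmap, PMF.bind_const]
  · intro B A hA j
    simp only [PMF.mem_support_bind_iff, PMF.mem_support_pure_iff] at hA
    obtain ⟨A', -, σ, hσ, rfl⟩ := hA
    rw [PMF.mem_support_uniformOfFinset_iff, Finset.mem_filter] at hσ
    rw [← hσ.2]
    exact Finset.map_subset_map.2 (hC A' j)

/-! ### Substrings -/

lemma sampleBits_congr {n m : ℕ} {w w' : Fin n → Bool}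
    {A : {s : Finset (Fin n) // s.card = m}} (h : ∀ k ∈ A.1, w k = w' k) :
    sampleBits w A = sampleBits w' A :=
  funext fun i => h _ (A.1.orderIsoOfFin A.2 i).2

lemma sampleBits_subsample {n m : ℕ} (w : Fin n → Bool)
    {A : {s : Finset (Fin n) // s.card = m}} {B : Finset (Fin n)} (h : A.1 ⊆ B) :
    sampleBits (fun k => (subsample w B k).getD false) A = sampleBits w A :=
  sampleBits_congr fun k hk => by simp [subsample, h hk]

/-- Spread the bits of a substring back to the positions it was read from. -/
def spreadBits {n m : ℕ} (A : {s : Finset (Fin n) // s.card = m}) (a : Fin m → Bool) :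
    Fin n → Option Bool :=
  fun k => if h : k ∈ A.1 then some (a ((A.1.orderIsoOfFin A.2).symm ⟨k, h⟩)) else none

lemma spreadBits_sampleBits {n m : ℕ} (w : Fin n → Bool)
    (A : {s : Finset (Fin n) // s.card = m}) :
    spreadBits A (sampleBits w A) = subsample w A.1 := by
  funext k
  by_cases h : k ∈ A.1 <;> simp [spreadBits, sampleBits, subsample, h]

/-! ### The hybrid argument -/

lemma PMF.uniformOfFintype_update_bind {ι X β : Type*} [Fintype ι] [DecidableEq ι] [Fintype X]
    [Nonempty X] (i : ι) (F : (ι → X) → PMF β) :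
    ((PMF.uniformOfFintype X).bind fun x => (PMF.uniformOfFintype (ι → X)).bind fun u =>
      F (Function.update u i x)) = (PMF.uniformOfFintype (ι → X)).bind F := by
  conv_rhs => rw [← PMF.uniformOfFintype_update i]
  rw [PMF.bind_comm]
  simp only [PMF.bind_bind, PMF.pure_bind]

lemma uniformSubsets_bind_of_kernel {α β : Type*} [Fintype α] [DecidableEq α] {m N ℓ : ℕ}
    {hm : m ≤ Fintype.card α} {hN : N ≤ Fintype.card α}
    {κ : {B : Finset α // B.card = N} → PMF (Fin ℓ → {A : Finset α // A.card = m})}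
    (hκ : (uniformSubset α N hN).bind κ = uniformSubsets α m ℓ hm) (i : Fin ℓ)
    (F : (Fin ℓ → {A : Finset α // A.card = m}) → PMF β) :
    ((uniformSubset α m hm).bind fun A₀ => (uniformSubset α N hN).bind fun B =>
      (κ B).bind fun A => F (Function.update A i A₀)) = (uniformSubsets α m ℓ hm).bind F := by
  have : Nonempty {A : Finset α // A.card = m} := mSub_nonempty hm
  simp only [← PMF.bind_bind, hκ]
  exact PMF.uniformOfFintype_update_bind i F

/-- The extractor outputs on the substrings `w[A j]`, the first `i` of them replaced by `u`. -/
def hybridOutput {n m ℓ : ℕ} {S V : Type} (E : (Fin m → Bool) → S → V) (i : ℕ)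
    (w : Fin n → Bool) (Z : S) (A : Fin ℓ → {A : Finset (Fin n) // A.card = m})
    (u : Fin ℓ → V) : Fin ℓ → V :=
  fun j => if j.val < i then u j else E (sampleBits w (A j)) Z

/-- The distribution of the extractor outputs, the seed and the subsets, the first `i` outputs
being replaced by uniform ones. -/
def hybrid {n m ℓ : ℕ} {S V : Type} [Fintype S] [Nonempty S] [Fintype V] [Nonempty V]
    (Wd : PMF (Fin n → Bool)) (E : (Fin m → Bool) → S → V)
    (hm : m ≤ Fintype.card (Fin n)) (i : ℕ) :
    PMF ((Fin ℓ → V) × S × (Fin ℓ → {A : Finset (Fin n) // A.card = m})) :=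
  Wd.bind fun w => (PMF.uniformOfFintype S).bind fun Z =>
    (uniformSubsets (Fin n) m ℓ hm).bind fun A =>
      (PMF.uniformOfFintype (Fin ℓ → V)).bind fun u =>
        PMF.pure (hybridOutput E i w Z A u, Z, A)

lemma update_hybridOutput {n m ℓ : ℕ} {S V : Type} (E : (Fin m → Bool) → S → V) (i : Fin ℓ)
    {w w' : Fin n → Bool} (Z : S) {A : Fin ℓ → {A : Finset (Fin n) // A.card = m}}
    (A₀ : {A : Finset (Fin n) // A.card = m}) (u : Fin ℓ → V)
    (h : ∀ j, sampleBits w' (A j) = sampleBits w (A j)) :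
    Function.update (hybridOutput E i w' Z (Function.update A i A₀) u) i
        (E (sampleBits w A₀) Z) =
      hybridOutput E i w Z (Function.update A i A₀) u := by
  funext j
  rcases eq_or_ne j i with rfl | hj
  · simp [hybridOutput]
  · simp [hybridOutput, hj, h]

lemma update_hybridOutput_succ {n m ℓ : ℕ} {S V : Type} (E : (Fin m → Bool) → S → V)
    (i : Fin ℓ) {w w' : Fin n → Bool} (Z : S)
    {A : Fin ℓ → {A : Finset (Fin n) // A.card = m}}
    (A₀ : {A : Finset (Fin n) // A.card = m}) (u : Fin ℓ → V) (v : V)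
    (h : ∀ j, sampleBits w' (A j) = sampleBits w (A j)) :
    Function.update (hybridOutput E i w' Z (Function.update A i A₀) u) i v =
      hybridOutput E (i + 1) w Z (Function.update A i A₀) (Function.update u i v) := by
  funext j
  rcases eq_or_ne j i with rfl | hj
  · simp [hybridOutput]
  · have : (j : ℕ) < i + 1 ↔ (j : ℕ) < i := by
      have := Fin.val_ne_of_ne hj
      omega
    simp [hybridOutput, hj, h, this]

/-- The joint law of the sampled substring and the adversary's view in an `(α,m,N)`-source. -/
def sampleView {n : ℕ} (Wd : PMF (Fin n → Bool)) (m N : ℕ)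
    (hm : m ≤ Fintype.card (Fin n)) (hN : N ≤ Fintype.card (Fin n)) :
    PMF ((Fin m → Bool) × (Fin n → Option Bool) ×
      {A : Finset (Fin n) // A.card = m} × {B : Finset (Fin n) // B.card = N}) :=
  Wd.bind fun w => (uniformSubset (Fin n) m hm).bind fun A =>
    (uniformSubset (Fin n) N hN).bind fun B =>
      PMF.pure (sampleBits w A, (subsample w B.1, A, B))

lemma IsAlphaSource.le_avgCondMinEntropy_sampleView {n : ℕ} {Wd : PMF (Fin n → Bool)} {α : ℝ}
    {m N : ℕ} {hm : m ≤ n} {hN : N ≤ n} (hW : IsAlphaSource n Wd α m N hm hN) :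
    α ≤ avgCondMinEntropy (sampleView Wd m N (by simpa using hm) (by simpa using hN)) := by
  refine le_trans (le_of_le_of_eq hW ?_)
    (avgCondMinEntropy_map_le _ fun a y => spreadBits y.2.1 a)
  simp only [sampleView, PMF.map_bind, PMF.pure_map, spreadBits_sampleBits]
  rfl

lemma statDist_hybrid_succ_le {n m N ℓ : ℕ} {S V : Type} [Fintype S] [Nonempty S] [Fintype V]
    [Nonempty V] {α ε : ℝ} {hm : m ≤ n} {hN : N ≤ n} {Wd : PMF (Fin n → Bool)}
    (hW : IsAlphaSource n Wd α m N hm hN) {E : (Fin m → Bool) → S → V}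
    (hE : IsAvgExtractor E α ε) (h : ℓ * m ≤ N) (i : Fin ℓ) :
    statDist (hybrid (ℓ := ℓ) Wd E (by simpa using hm) i)
      (hybrid (ℓ := ℓ) Wd E (by simpa using hm) (i + 1)) ≤ ε := by
  have hm' : m ≤ Fintype.card (Fin n) := by simpa using hm
  have hN' : N ≤ Fintype.card (Fin n) := by simpa using hN
  obtain ⟨κ, hκ, hsub⟩ := exists_kernel_uniformSubsets (ℓ := ℓ) hm' hN' h
  let K : V × ((Fin n → Option Bool) × {A : Finset (Fin n) // A.card = m} ×
      {B : Finset (Fin n) // B.card = N}) × S →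
      PMF ((Fin ℓ → V) × S × (Fin ℓ → {A : Finset (Fin n) // A.card = m})) := fun x =>
    (κ x.2.1.2.2).bind fun A => (PMF.uniformOfFintype (Fin ℓ → V)).bind fun u =>
      PMF.pure (Function.update (hybridOutput E i (fun k => (x.2.1.1 k).getD false) x.2.2
        (Function.update A i x.2.1.2.1) u) i x.1, x.2.2, Function.update A i x.2.1.2.1)
  have hdist := hE _ _ hW.le_avgCondMinEntropy_sampleView
  refine le_trans (le_of_eq ?_) ((statDist_bind_le _ _ K).trans hdist)
  congr 1
  · simp only [hybrid, sampleView, pmfProd, PMF.map, PMF.bind_bind, PMF.pure_bind,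
      Function.comp_apply, K]
    refine congrArg Wd.bind (funext fun w => ?_)
    simp only [PMF.bind_comm _ (PMF.uniformOfFintype S)]
    refine congrArg (PMF.bind _) (funext fun Z => ?_)
    rw [← uniformSubsets_bind_of_kernel hκ i]
    refine congrArg (PMF.bind _) (funext fun A₀ => congrArg (PMF.bind _) (funext fun B => ?_))
    refine PMF.bind_congr_support _ fun A hA => ?_
    simp only [update_hybridOutput E i Z A₀ _
      fun j => sampleBits_subsample w (hsub B A hA j)]
  · simp only [hybrid, sampleView, pmfProd, PMF.map, PMF.bind_bind, PMF.pure_bind,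
      Function.comp_apply, K]
    refine congrArg Wd.bind (funext fun w => ?_)
    simp only [PMF.bind_comm _ (PMF.uniformOfFintype S)]
    refine congrArg (PMF.bind _) (funext fun Z => ?_)
    rw [← uniformSubsets_bind_of_kernel hκ i]
    refine congrArg (PMF.bind _) (funext fun A₀ => congrArg (PMF.bind _) (funext fun B => ?_))
    rw [PMF.bind_comm (PMF.uniformOfFintype V)]
    refine PMF.bind_congr_support _ fun A hA => ?_
    rw [← PMF.uniformOfFintype_update_bind i]
    simp only [update_hybridOutput_succ E i Z A₀ _ _
      fun j => sampleBits_subsample w (hsub B A hA j)]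

/-- Adding a fixed string to every coordinate of a uniform family leaves it uniform. -/
lemma PMF.uniformOfFintype_xor_bind {ι κ β : Type*} [Fintype ι] [DecidableEq ι] [Fintype κ]
    [DecidableEq κ] (c : κ → Bool) (F : (ι → κ → Bool) → PMF β) :
    ((PMF.uniformOfFintype (ι → κ → Bool)).bind fun u => F fun i j => Bool.xor (u i j) (c j)) =
      (PMF.uniformOfFintype (ι → κ → Bool)).bind F := by
  have hinv : Function.Involutive
      fun (u : ι → κ → Bool) i j => Bool.xor (u i j) (c j) := by
    intro u
    simp
  conv_rhs => rw [← PMF.uniformOfFintype_map_equiv hinv.toPerm, PMF.bind_map]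
  rfl

/-- Construction 2 with a tag: `ν = t + ξ + 2λ`,
`p_i = E(W[A_i],Z) ⊕ (0^t | R | R₁)`, `T = f(R₁,(p,Z,A))` for an arbitrary function `f`
into a finite set.  If `ℓ·m < N`, then
`Δ((R, p, Z, A, T); (U, p, Z, A, T)) ≤ 4ℓ·ε` where `U` is uniform over `{0,1}^ξ`
independent of all the other variables. -/
theorem key_close_to_uniform_given_helper_and_tag
    (n m N t ξ lam r ℓ : ℕ) (α ε : ℝ) (hm : m ≤ n) (hN : N ≤ n)
    (Wd : PMF (Fin n → Bool)) (hW : IsAlphaSource n Wd α m N hm hN)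
    (E : (Fin m → Bool) → (Fin r → Bool) → (Fin (t + (ξ + 2 * lam)) → Bool))
    (hE : IsAvgExtractor E α ε)
    (hEunif :
      (pmfProd (PMF.uniformOfFintype (Fin m → Bool))
          (PMF.uniformOfFintype (Fin r → Bool))).map (fun z => E z.1 z.2) =
        PMF.uniformOfFintype (Fin (t + (ξ + 2 * lam)) → Bool))
    (𝒯 : Type) [Fintype 𝒯]
    (f : (Fin (2 * lam) → Bool) →
      ((Fin ℓ → Fin (t + (ξ + 2 * lam)) → Bool) × (Fin r → Bool) ×
        (Fin ℓ → {A : Finset (Fin n) // A.card = m})) → 𝒯)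
    (hk : ℓ * m < N) :
    statDist
      (do
        let w ← Wd
        let Z ← PMF.uniformOfFintype (Fin r → Bool)
        let A ← uniformSubsets (Fin n) m ℓ (by simpa using hm)
        let R ← PMF.uniformOfFintype (Fin ξ → Bool)
        let R1 ← PMF.uniformOfFintype (Fin (2 * lam) → Bool)
        let p : Fin ℓ → Fin (t + (ξ + 2 * lam)) → Bool :=
          fun i j => Bool.xor (E (sampleBits w (A i)) Z j)
            (Fin.append (fun _ : Fin t => false) (Fin.append R R1) j)
        return (R, p, Z, A, f R1 (p, Z, A)))
      (do
        let w ← Wd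
        let Z ← PMF.uniformOfFintype (Fin r → Bool)
        let A ← uniformSubsets (Fin n) m ℓ (by simpa using hm)
        let R ← PMF.uniformOfFintype (Fin ξ → Bool)
        let R1 ← PMF.uniformOfFintype (Fin (2 * lam) → Bool)
        let U ← PMF.uniformOfFintype (Fin ξ → Bool)
        let p : Fin ℓ → Fin (t + (ξ + 2 * lam)) → Bool :=
          fun i j => Bool.xor (E (sampleBits w (A i)) Z j)
            (Fin.append (fun _ : Fin t => false) (Fin.append R R1) j)
        return (U, p, Z, A, f R1 (p, Z, A)))
      ≤ 4 * ℓ * ε := by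
  have hm' : m ≤ Fintype.card (Fin n) := by simpa using hm
  let X := (Fin ℓ → Fin (t + (ξ + 2 * lam)) → Bool) × (Fin r → Bool) ×
    (Fin ℓ → {A : Finset (Fin n) // A.card = m})
  let mask (R : Fin ξ → Bool) (R1 : Fin (2 * lam) → Bool) (x : X) : X :=
    (fun i j => Bool.xor (x.1 i j)
      (Fin.append (fun _ : Fin t => false) (Fin.append R R1) j), x.2)
  let K₁ (x : X) : PMF ((Fin ξ → Bool) × (Fin ℓ → Fin (t + (ξ + 2 * lam)) → Bool) ×
      (Fin r → Bool) × (Fin ℓ → {A : Finset (Fin n) // A.card = m}) × 𝒯) :=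
    (PMF.uniformOfFintype (Fin ξ → Bool)).bind fun R =>
      (PMF.uniformOfFintype (Fin (2 * lam) → Bool)).bind fun R1 =>
        PMF.pure (R, (mask R R1 x).1, x.2.1, x.2.2, f R1 (mask R R1 x))
  let K₂ (x : X) : PMF ((Fin ξ → Bool) × (Fin ℓ → Fin (t + (ξ + 2 * lam)) → Bool) ×
      (Fin r → Bool) × (Fin ℓ → {A : Finset (Fin n) // A.card = m}) × 𝒯) :=
    (PMF.uniformOfFintype (Fin ξ → Bool)).bind fun R =>
      (PMF.uniformOfFintype (Fin (2 * lam) → Bool)).bind fun R1 =>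
        (PMF.uniformOfFintype (Fin ξ → Bool)).bind fun U =>
          PMF.pure (U, (mask R R1 x).1, x.2.1, x.2.2, f R1 (mask R R1 x))
  let D (i : ℕ) : PMF X := hybrid Wd E hm' i
  have hchain : statDist (D 0) (D ℓ) ≤ ℓ * ε :=
    statDist_le_of_chain D ε ℓ fun i hi =>
      statDist_hybrid_succ_le hW hE hk.le ⟨i, hi⟩
  have hideal : (D ℓ).bind K₁ = (D ℓ).bind K₂ := by
    have hu : ∀ w Z A (u : Fin ℓ → Fin (t + (ξ + 2 * lam)) → Bool),
        hybridOutput E ℓ (n := n) w Z A u = u := by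
      intro w Z A u
      funext j
      simp [hybridOutput]
    simp only [D, K₁, K₂, mask, hybrid, hu, PMF.bind_bind, PMF.pure_bind]
    refine congrArg Wd.bind (funext fun w => congrArg (PMF.bind _) (funext fun Z =>
      congrArg (PMF.bind _) (funext fun A => ?_)))
    have hswap : ∀ {β : Type} (F : (Fin ξ → Bool) → (Fin (2 * lam) → Bool) →
        (Fin ℓ → Fin (t + (ξ + 2 * lam)) → Bool) → PMF β),
        ((PMF.uniformOfFintype (Fin ℓ → Fin (t + (ξ + 2 * lam)) → Bool)).bind fun u =>
          (PMF.uniformOfFintype (Fin ξ → Bool)).bind fun R =>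
            (PMF.uniformOfFintype (Fin (2 * lam) → Bool)).bind fun R1 =>
              F R R1 fun i j => Bool.xor (u i j)
                (Fin.append (fun _ : Fin t => false) (Fin.append R R1) j)) =
        (PMF.uniformOfFintype (Fin ξ → Bool)).bind fun R =>
          (PMF.uniformOfFintype (Fin (2 * lam) → Bool)).bind fun R1 =>
            (PMF.uniformOfFintype (Fin ℓ → Fin (t + (ξ + 2 * lam)) → Bool)).bind (F R R1) := by
      intro β F
      rw [PMF.bind_comm]
      refine congrArg (PMF.bind _) (funext fun R => ?_)
      rw [PMF.bind_comm]
      exact congrArg (PMF.bind _) (funext fun R1 =>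
        PMF.uniformOfFintype_xor_bind _ (F R R1))
    rw [hswap fun R R1 p => PMF.pure (R, p, Z, A, f R1 (p, Z, A)),
      hswap fun _ R1 p => (PMF.uniformOfFintype (Fin ξ → Bool)).bind fun U =>
        PMF.pure (U, p, Z, A, f R1 (p, Z, A)), PMF.bind_const, PMF.bind_comm]
    refine congrArg (PMF.bind _) (funext fun R1 => ?_)
    rw [PMF.bind_comm]
  have hreal : ∀ K : X → PMF ((Fin ξ → Bool) × (Fin ℓ → Fin (t + (ξ + 2 * lam)) → Bool) ×
      (Fin r → Bool) × (Fin ℓ → {A : Finset (Fin n) // A.card = m}) × 𝒯),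
      (D 0).bind K = Wd.bind fun w => (PMF.uniformOfFintype (Fin r → Bool)).bind fun Z =>
        (uniformSubsets (Fin n) m ℓ hm').bind fun A =>
          K (fun i => E (sampleBits w (A i)) Z, Z, A) := by
    intro K
    have hu : ∀ w Z A (u : Fin ℓ → Fin (t + (ξ + 2 * lam)) → Bool),
        hybridOutput E 0 (n := n) w Z A u = fun i => E (sampleBits w (A i)) Z := by
      intro w Z A u
      funext j
      simp [hybridOutput]
    simp only [D, hybrid, hu, PMF.bind_bind, PMF.pure_bind, PMF.bind_const]
  have h₁ := (statDist_bind_le (D 0) (D ℓ) K₁).trans hchain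
  have h₂ := (statDist_bind_le (D 0) (D ℓ) K₂).trans hchain
  have hnonneg : 0 ≤ ℓ * ε := (statDist_nonneg _ _).trans hchain
  have htri := statDist_triangle ((D 0).bind K₁) ((D ℓ).bind K₁) ((D 0).bind K₂)
  rw [statDist_comm ((D ℓ).bind K₁), hideal] at htri
  rw [hideal] at h₁
  have hmain : statDist ((D 0).bind K₁) ((D 0).bind K₂) ≤ 4 * ℓ * ε := by linarith
  rw [hreal K₁, hreal K₂] at hmain
  exact hmain

end
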